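/- The Expected Confidence Dependency is monotone with respect to refinement of the conditional partition: if c₂ induces a finer partition than c₁ (that is, for all x, y ∈ U, c₂(x) = c₂(y) implies c₁(x) = c₁(y)), then ECD(c₁,d) ≤ ECD(c₂,d). -/

import Mathlib

open Finset

/-- Classification confidence `Conf(X→Y) = |X∩Y|/|X|` for the conditional block
`X = c⁻¹(a)` and decision class `Y = d⁻¹(b)`. -/
def Conf {U A B : Type*} [Fintype U] [DecidableEq A] [DecidableEq B]
    (c : U → A) (d : U → B) (a : A) (b : B) : ℚ :=
  ((univ.filter fun x => c x = a ∧ d x = b).card : ℚ) /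
    ((univ.filter fun x => c x = a).card : ℚ)

/-- Expected Confidence Dependency:
`ECD(c,d) = (1/|U|) · Σ_{X ∈ U/c} |X| · max_{Y ∈ U/d} Conf(X→Y)`. -/
def ECD {U A B : Type*} [Fintype U] [Nonempty U] [DecidableEq A] [DecidableEq B]
    (c : U → A) (d : U → B) : ℚ :=
  (∑ a ∈ univ.image c,
      ((univ.filter fun x => c x = a).card : ℚ) *
        (univ.image d).sup' (univ_nonempty.image d) (fun b => Conf c d a b))
    / (Fintype.card U : ℚ)

theorem card_mul_Conf {U A B : Type*} [Fintype U] [DecidableEq A] [DecidableEq B]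
    (c : U → A) (d : U → B) (a : A) (b : B) :
    ((univ.filter fun x => c x = a).card : ℚ) * Conf c d a b =
      ((univ.filter fun x => c x = a ∧ d x = b).card : ℚ) := by
  refine mul_div_cancel_of_imp' fun h => ?_
  rw [Nat.cast_eq_zero, card_eq_zero] at h
  rw [← filter_filter, h, filter_empty, card_empty, Nat.cast_zero]

theorem card_inter_le_card_mul_sup_Conf {U A B : Type*} [Fintype U] [Nonempty U]
    [DecidableEq A] [DecidableEq B] (c : U → A) (d : U → B) (a : A) {b : B}
    (hb : b ∈ univ.image d) :
    ((univ.filter fun x => c x = a ∧ d x = b).card : ℚ) ≤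
      ((univ.filter fun x => c x = a).card : ℚ) *
        (univ.image d).sup' (univ_nonempty.image d) (fun b => Conf c d a b) := by
  rw [← card_mul_Conf]
  exact mul_le_mul_of_nonneg_left (le_sup' (fun b => Conf c d a b) hb) (Nat.cast_nonneg _)

/-- Monotonicity under refinement of the conditional partition: if `c₂` induces
a finer partition than `c₁`, then `ECD(c₁,d) ≤ ECD(c₂,d)`. -/
theorem ECD_mono {U A₁ A₂ B : Type*} [Fintype U] [Nonempty U]
    [DecidableEq A₁] [DecidableEq A₂] [DecidableEq B]
    (c₁ : U → A₁) (c₂ : U → A₂) (d : U → B)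
    (hfine : ∀ x y : U, c₂ x = c₂ y → c₁ x = c₁ y) :
    ECD c₁ d ≤ ECD c₂ d := by
  have : Nonempty A₁ := Nonempty.map c₁ inferInstance
  obtain ⟨g, hg⟩ := (Function.factorsThrough_iff c₁).1 fun x y h => hfine x y h
  have hg' : ∀ x, c₁ x = g (c₂ x) := congrFun hg
  have maps : ∀ a' ∈ univ.image c₂, g a' ∈ univ.image c₁ := by
    intro a' ha'
    obtain ⟨x, -, rfl⟩ := mem_image.1 ha'
    exact mem_image.2 ⟨x, mem_univ x, hg' x⟩
  unfold ECD
  refine div_le_div_of_nonneg_right ?_ (Nat.cast_nonneg _)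
  rw [← sum_fiberwise_of_maps_to maps]
  refine sum_le_sum fun a _ => ?_
  obtain ⟨b, hb, hsup⟩ := exists_mem_eq_sup' (univ_nonempty.image d) (fun b => Conf c₁ d a b)
  rw [hsup, card_mul_Conf]
  refine le_trans (le_of_eq ?_)
    (sum_le_sum fun a' _ => card_inter_le_card_mul_sup_Conf c₂ d a' hb)
  rw [← Nat.cast_sum, Nat.cast_inj]
  have hmem : ∀ x ∈ univ.filter (fun x => c₁ x = a ∧ d x = b),
      c₂ x ∈ (univ.image c₂).filter fun a' => g a' = a := by
    intro x hx
    simp only [mem_filter, mem_univ, true_and] at hx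
    exact mem_filter.2 ⟨mem_image_of_mem _ (mem_univ x), (hg' x).symm.trans hx.1⟩
  rw [card_eq_sum_card_fiberwise hmem]
  refine sum_congr rfl fun a' ha' => congrArg card ?_
  have ha := (mem_filter.1 ha').2
  ext x
  simp only [mem_filter, mem_univ, true_and, hg']
  constructor
  · rintro ⟨⟨-, h⟩, h'⟩
    exact ⟨h', h⟩
  · rintro ⟨rfl, h⟩
    exact ⟨⟨ha, h⟩, rfl⟩
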